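/- arXiv:2204.06793 — 3 statements merged into one kernel-verified Lean document; each statement's English description precedes it below -/
import Mathlib

section
/- Let ν : ℝ^d \ {0} → [0,∞) be measurable and radial. If the energy ∬_{ℝ^d×ℝ^d} (u(x) − u(y))² ν(x−y) dx dy is finite for every u ∈ C_c^∞(ℝ^d), then ν satisfies the Lévy condition ∫_{ℝ^d} min(1,|h|²) ν(h) dh < ∞. -/
open MeasureTheory Set Metric ENNReal

theorem levy_aux_pointwise {d : ℕ} (φ ψ : EuclideanSpace ℝ (Fin d) → ℝ)
    (hφ : ∀ x, ‖x‖ ≤ 4 → φ x = 1) (hψ : ∀ x, ‖x‖ ≤ 1 → ψ x = 1) (hψ' : ∀ x, 2 ≤ ‖x‖ → ψ x = 0)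
    (x y : EuclideanSpace ℝ (Fin d)) (hx : ‖x‖ ≤ 1) :
    min 1 (‖x - y‖ ^ 2) ≤ (∑ i, (x i * φ x - y i * φ y) ^ 2) + (ψ x - ψ y) ^ 2 := by
  by_cases h : ‖y‖ ≤ 4
  · refine (min_le_right _ _).trans ?_
    rw [EuclideanSpace.norm_sq_eq, hφ x (by linarith), hφ y h]
    simp only [PiLp.sub_apply, mul_one, Real.norm_eq_abs, sq_abs]
    linarith [sq_nonneg (ψ x - ψ y)]
  · refine (min_le_left _ _).trans ?_
    rw [hψ x hx, hψ' y (by linarith)]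
    have : 0 ≤ ∑ i, (x i * φ x - y i * φ y) ^ 2 := Finset.sum_nonneg fun i _ => sq_nonneg _
    linarith

/-- If a measurable radial nonnegative kernel has finite nonlocal
energy on every smooth compactly supported function, then it satisfies the
Lévy integrability condition. -/
theorem energy_finite_implies_levy_condition
    (d : ℕ) (ν : EuclideanSpace ℝ (Fin d) → ℝ≥0∞)
    (hmeas : Measurable ν)
    (f : ℝ → ℝ≥0∞) (hrad : ∀ h, ν h = f ‖h‖)
    (hfin : ∀ u : EuclideanSpace ℝ (Fin d) → ℝ, ContDiff ℝ (⊤ : ℕ∞) u → HasCompactSupport u →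
      ∫⁻ x, ∫⁻ y, ENNReal.ofReal ((u x - u y) ^ 2) * ν (x - y) < ⊤) :
    ∫⁻ h, ENNReal.ofReal (min 1 (‖h‖ ^ 2)) * ν h < ⊤ := by
  let Φ : ContDiffBump (0 : EuclideanSpace ℝ (Fin d)) := ⟨4, 5, by norm_num, by norm_num⟩
  let Ψ : ContDiffBump (0 : EuclideanSpace ℝ (Fin d)) := ⟨1, 2, by norm_num, by norm_num⟩
  have hφ : ∀ x, ‖x‖ ≤ 4 → Φ x = 1 := fun x hx =>
    Φ.one_of_mem_closedBall (by simpa [Φ] using hx)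
  have hψ : ∀ x, ‖x‖ ≤ 1 → Ψ x = 1 := fun x hx =>
    Ψ.one_of_mem_closedBall (by simpa [Ψ] using hx)
  have hψ' : ∀ x, 2 ≤ ‖x‖ → Ψ x = 0 := fun x hx =>
    Ψ.zero_of_le_dist (by simpa [Ψ] using hx)
  have key : ∀ u : EuclideanSpace ℝ (Fin d) → ℝ, Continuous u →
      Measurable (Function.uncurry fun x y => ENNReal.ofReal ((u x - u y) ^ 2) * ν (x - y)) := by
    intro u hu
    have := hu.measurable
    unfold Function.uncurry
    fun_prop
  have cu : ∀ i : Fin d, ContDiff ℝ (⊤ : ℕ∞) (fun x : EuclideanSpace ℝ (Fin d) => x i * Φ x) := by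
    intro i
    have := Φ.contDiff (n := (⊤ : ℕ∞))
    fun_prop
  have cs : ∀ i : Fin d, HasCompactSupport (fun x : EuclideanSpace ℝ (Fin d) => x i * Φ x) :=
    fun i => Φ.hasCompactSupport.mul_left
  have cψ := Ψ.contDiff (n := (⊤ : ℕ∞))
  have hS : (∑ i : Fin d, ∫⁻ x : EuclideanSpace ℝ (Fin d), ∫⁻ y : EuclideanSpace ℝ (Fin d),
        ENNReal.ofReal ((x i * Φ x - y i * Φ y) ^ 2) * ν (x - y))
      + ∫⁻ x, ∫⁻ y, ENNReal.ofReal ((Ψ x - Ψ y) ^ 2) * ν (x - y) < ⊤ := by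
    refine ENNReal.add_lt_top.2 ⟨ENNReal.sum_lt_top.2 fun i _ => hfin _ (cu i) (cs i),
      hfin _ cψ Ψ.hasCompactSupport⟩
  have mu := fun i => key _ (cu i).continuous
  have mψ := key _ cψ.continuous
  have hle : (∫⁻ h, ENNReal.ofReal (min 1 (‖h‖ ^ 2)) * ν h) *
      volume (closedBall (0 : EuclideanSpace ℝ (Fin d)) 1) < ⊤ := by
    refine lt_of_le_of_lt ?_ hS
    rw [← lintegral_finset_sum _ (fun i _ => (mu i).lintegral_prod_right),
      ← lintegral_add_right _ mψ.lintegral_prod_right, ← setLIntegral_const]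
    refine le_trans (setLIntegral_mono' measurableSet_closedBall ?_) (setLIntegral_le_lintegral _ _)
    intro x hx
    have hx : ‖x‖ ≤ 1 := by simpa using hx
    rw [← lintegral_finset_sum _ (fun i _ => (mu i).of_uncurry_left),
      ← lintegral_add_right _ mψ.of_uncurry_left,
      ← lintegral_sub_left_eq_self _ x]
    refine lintegral_mono fun y => ?_
    dsimp only
    rw [← Finset.sum_mul, ← add_mul, ← ENNReal.ofReal_sum_of_nonneg (fun i _ => sq_nonneg _),
      ← ENNReal.ofReal_add (Finset.sum_nonneg fun i _ => sq_nonneg _) (sq_nonneg _)]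
    gcongr
    exact levy_aux_pointwise _ _ hφ hψ hψ' x y hx
  by_contra hc
  rw [not_lt, top_le_iff] at hc
  rw [hc, ENNReal.top_mul (measure_closedBall_pos _ _ one_pos).ne'] at hle
  exact lt_irrefl _ hle
end

section
/- Let Ω ⊂ ℝ^d be open and bounded, k : ℝ^d×ℝ^d → [0,∞) symmetric measurable with Λ^{−1}ν(y−x) ≤ k(x,y) ≤ Λν(y−x) for a symmetric Lévy density ν of full support, and suppose the Poincaré inequality ‖v‖²_{L²(Ω)} ≤ C₀ E(v,v) holds for all v ∈ V_ν(Ω|ℝ^d)^⊥ = {v ∈ V_ν(Ω|ℝ^d) : ∫_Ω v = 0}, where E(u,v) = (1/2)∬_{(Ω^c×Ω^c)^c}(u(x)−u(y))(v(x)−v(y)) k(x,y) dx dy. Then for f ∈ V_ν(Ω|ℝ^d)' and g ∈ T_ν(Ω^c)' there exists a unique u ∈ V_ν(Ω|ℝ^d)^⊥ with E(u,v) = ⟨f,v⟩ + ⟨g, v|_{Ω^c}⟩ for all v ∈ V_ν(Ω|ℝ^d)^⊥, and ‖u‖_{V_ν(Ω|ℝ^d)} ≤ C(‖f‖ + ‖g‖)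 for a constant C independent of f, g. -/
open MeasureTheory Set Metric ENNReal NNReal

/-- The squared norm of the energy space `V_ν(Ω|ℝ^d)` (as a value in `[0,∞]`). -/
noncomputable def Vnorm2 {d : ℕ} (Ω : Set (EuclideanSpace ℝ (Fin d)))
    (ν : EuclideanSpace ℝ (Fin d) → ℝ) (u : EuclideanSpace ℝ (Fin d) → ℝ) : ℝ≥0∞ :=
  (∫⁻ x in Ω, ENNReal.ofReal ((u x) ^ 2)) +
    ∫⁻ p in Ω ×ˢ univ, ENNReal.ofReal ((u p.1 - u p.2) ^ 2 * ν (p.1 - p.2))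
      ∂(volume.prod volume)

/-- Membership in the energy space `V_ν(Ω|ℝ^d)`. -/
def MemV {d : ℕ} (Ω : Set (EuclideanSpace ℝ (Fin d)))
    (ν : EuclideanSpace ℝ (Fin d) → ℝ) (u : EuclideanSpace ℝ (Fin d) → ℝ) : Prop :=
  Measurable u ∧ Vnorm2 Ω ν u < ⊤

/-- The bilinear energy form `E(u,v)` associated with the kernel `k`. -/
noncomputable def EForm {d : ℕ} (Ω : Set (EuclideanSpace ℝ (Fin d)))
    (k : EuclideanSpace ℝ (Fin d) → EuclideanSpace ℝ (Fin d) → ℝ)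
    (u v : EuclideanSpace ℝ (Fin d) → ℝ) : ℝ :=
  (1 / 2) * ∫ p in (Ωᶜ ×ˢ Ωᶜ)ᶜ, (u p.1 - u p.2) * (v p.1 - v p.2) * k p.1 p.2
    ∂(volume.prod volume)


open Filter Topology

theorem aux_riesz {V H : Type*} [AddCommGroup V] [Module ℝ V] [NormedAddCommGroup H]
    [InnerProductSpace ℝ H] [CompleteSpace H] (T : V →ₗ[ℝ] H)
    (hT : IsClosed (LinearMap.range T : Set H)) (l : V →ₗ[ℝ] ℝ) (M : ℝ)
    (hl : ∀ v, |l v| ≤ M * ‖T v‖) : ∃ u, ∀ v, inner ℝ (T u) (T v) = l v := by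
  have hker : LinearMap.ker T ≤ LinearMap.ker l := by
    intro v hv
    rw [LinearMap.mem_ker] at hv ⊢
    have := hl v
    rw [hv, norm_zero, mul_zero] at this
    exact abs_nonpos_iff.mp this
  have : l ∈ LinearMap.range T.dualMap := by
    rw [LinearMap.range_dualMap_eq_dualAnnihilator_ker, Submodule.mem_dualAnnihilator]
    intro w hw
    exact hker hw
  obtain ⟨φ, hφ⟩ := this
  have hφ' : ∀ v, φ (T v) = l v := fun v => by rw [← hφ]; rfl
  have : CompleteSpace (LinearMap.range T) := hT.completeSpace_coe
  let ψ : StrongDual ℝ (LinearMap.range T) :=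
    LinearMap.mkContinuous (φ ∘ₗ (LinearMap.range T).subtype) M (by
      rintro ⟨_, v, rfl⟩
      simpa [hφ'] using hl v)
  obtain ⟨u, hu⟩ := ((InnerProductSpace.toDual ℝ (LinearMap.range T)).symm ψ).2
  refine ⟨u, fun v => ?_⟩
  have h := InnerProductSpace.toDual_symm_apply (𝕜 := ℝ)
    (x := (⟨T v, v, rfl⟩ : LinearMap.range T)) (y := ψ)
  rw [Submodule.coe_inner, ← hu] at h
  rw [h]
  exact hφ' v

theorem aux_memLp {α : Type*} [MeasurableSpace α] {μ : Measure α} {h : α → ℝ} (hm : Measurable h) :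
    MemLp h 2 μ ↔ ∫⁻ x, ENNReal.ofReal ((h x) ^ 2) ∂μ < ⊤ := by
  rw [memLp_two_iff_integrable_sq hm.aestronglyMeasurable, Integrable,
    hasFiniteIntegral_iff_ofReal (Eventually.of_forall fun x => sq_nonneg _)]
  exact and_iff_right (hm.pow_const 2).aestronglyMeasurable

/-- the kernel measure -/
noncomputable def auxM {d : ℕ} (Ω : Set (EuclideanSpace ℝ (Fin d)))
    (k : EuclideanSpace ℝ (Fin d) → EuclideanSpace ℝ (Fin d) → ℝ) :
    Measure (EuclideanSpace ℝ (Fin d) × EuclideanSpace ℝ (Fin d)) :=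
  ((volume.prod volume).restrict (Ωᶜ ×ˢ Ωᶜ)ᶜ).withDensity fun p => ENNReal.ofReal (k p.1 p.2)

/-- difference function -/
def auxD {d : ℕ} (v : EuclideanSpace ℝ (Fin d) → ℝ) :
    EuclideanSpace ℝ (Fin d) × EuclideanSpace ℝ (Fin d) → ℝ := fun p => v p.1 - v p.2

theorem auxD_meas {d : ℕ} {v : EuclideanSpace ℝ (Fin d) → ℝ} (hv : Measurable v) :
    Measurable (auxD v) := by unfold auxD; fun_prop

theorem aux_EForm {d : ℕ} (Ω : Set (EuclideanSpace ℝ (Fin d)))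
    (k : EuclideanSpace ℝ (Fin d) → EuclideanSpace ℝ (Fin d) → ℝ)
    (hkm : Measurable (Function.uncurry k)) (hk0 : ∀ x y, 0 ≤ k x y)
    (u v : EuclideanSpace ℝ (Fin d) → ℝ) :
    EForm Ω k u v = (1 / 2) * ∫ p, auxD u p * auxD v p ∂(auxM Ω k) := by
  unfold EForm auxM
  have hkm' : Measurable fun p : EuclideanSpace ℝ (Fin d) × EuclideanSpace ℝ (Fin d) =>
    ENNReal.ofReal (k p.1 p.2) := hkm.ennreal_ofReal
  rw [integral_withDensity_eq_integral_toReal_smul hkm'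
    (Eventually.of_forall fun _ => ENNReal.ofReal_lt_top)]
  congr 2
  ext p
  rw [ENNReal.toReal_ofReal (hk0 _ _), smul_eq_mul, mul_comm]
  rfl

theorem aux_lint {d : ℕ} (Ω : Set (EuclideanSpace ℝ (Fin d)))
    (k : EuclideanSpace ℝ (Fin d) → EuclideanSpace ℝ (Fin d) → ℝ)
    (hkm : Measurable (Function.uncurry k)) (hk0 : ∀ x y, 0 ≤ k x y)
    (v : EuclideanSpace ℝ (Fin d) → ℝ) (hv : Measurable v) :
    ∫⁻ p, ENNReal.ofReal ((auxD v p) ^ 2) ∂(auxM Ω k) =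
      ∫⁻ p in (Ωᶜ ×ˢ Ωᶜ)ᶜ, ENNReal.ofReal ((v p.1 - v p.2) ^ 2 * k p.1 p.2)
        ∂(volume.prod volume) := by
  unfold auxM
  have hkm' : Measurable fun p : EuclideanSpace ℝ (Fin d) × EuclideanSpace ℝ (Fin d) =>
    ENNReal.ofReal (k p.1 p.2) := hkm.ennreal_ofReal
  rw [lintegral_withDensity_eq_lintegral_mul _ hkm' ((auxD_meas hv).pow_const 2).ennreal_ofReal]
  congr 1
  ext p
  rw [Pi.mul_apply, mul_comm, ENNReal.ofReal_mul (sq_nonneg _)]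
  rfl

theorem aux_lower {d : ℕ} (Ω : Set (EuclideanSpace ℝ (Fin d)))
    (ν : EuclideanSpace ℝ (Fin d) → ℝ)
    (hνs : ∀ h, ν (-h) = ν h)
    (k : EuclideanSpace ℝ (Fin d) → EuclideanSpace ℝ (Fin d) → ℝ)
    (hkm : Measurable (Function.uncurry k)) (hk0 : ∀ x y, 0 ≤ k x y)
    (Λ : ℝ) (hΛ : 1 ≤ Λ) (hk : ∀ x y, Λ⁻¹ * ν (y - x) ≤ k x y)
    (v : EuclideanSpace ℝ (Fin d) → ℝ) (hv : Measurable v) :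
    ∫⁻ p in Ω ×ˢ univ, ENNReal.ofReal ((v p.1 - v p.2) ^ 2 * ν (p.1 - p.2))
      ∂(volume.prod volume) ≤
    ENNReal.ofReal Λ * ∫⁻ p, ENNReal.ofReal ((auxD v p) ^ 2) ∂(auxM Ω k) := by
  rw [aux_lint Ω k hkm hk0 v hv, ← lintegral_const_mul' _ _ ENNReal.ofReal_ne_top]
  refine (lintegral_mono_set (t := (Ωᶜ ×ˢ Ωᶜ)ᶜ) ?_).trans (lintegral_mono fun p => ?_)
  · rintro ⟨x, y⟩ ⟨hx, -⟩ ⟨hx', -⟩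
    exact hx' hx
  · dsimp only
    rw [← ENNReal.ofReal_mul (by linarith)]
    apply ENNReal.ofReal_le_ofReal
    have h1 : ν (p.1 - p.2) ≤ Λ * k p.1 p.2 := by
      have := hk p.1 p.2
      rw [inv_mul_le_iff₀ (by linarith)] at this
      rwa [← hνs, neg_sub]
    calc (v p.1 - v p.2) ^ 2 * ν (p.1 - p.2) ≤ (v p.1 - v p.2) ^ 2 * (Λ * k p.1 p.2) := by gcongr
      _ = _ := by ring

theorem aux_upper {d : ℕ} (Ω : Set (EuclideanSpace ℝ (Fin d)))
    (ν : EuclideanSpace ℝ (Fin d) → ℝ)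
    (hνs : ∀ h, ν (-h) = ν h)
    (k : EuclideanSpace ℝ (Fin d) → EuclideanSpace ℝ (Fin d) → ℝ)
    (hkm : Measurable (Function.uncurry k)) (hk0 : ∀ x y, 0 ≤ k x y)
    (hΩ : MeasurableSet Ω)
    (Λ : ℝ) (hΛ : 1 ≤ Λ) (hk : ∀ x y, k x y ≤ Λ * ν (y - x))
    (v : EuclideanSpace ℝ (Fin d) → ℝ) (hv : Measurable v) :
    ∫⁻ p, ENNReal.ofReal ((auxD v p) ^ 2) ∂(auxM Ω k) ≤
    ENNReal.ofReal Λ * (2 * ∫⁻ p in Ω ×ˢ univ,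
      ENNReal.ofReal ((v p.1 - v p.2) ^ 2 * ν (p.1 - p.2)) ∂(volume.prod volume)) := by
  rw [aux_lint Ω k hkm hk0 v hv]
  set F : EuclideanSpace ℝ (Fin d) × EuclideanSpace ℝ (Fin d) → ℝ≥0∞ := fun p =>
    ENNReal.ofReal ((v p.1 - v p.2) ^ 2 * ν (p.1 - p.2)) with hF
  have hFs : ∀ p, F p.swap = F p := by
    intro p
    simp only [hF, Prod.fst_swap, Prod.snd_swap]
    rw [← hνs (p.1 - p.2), neg_sub, sub_sq_comm]
  calc _ ≤ ∫⁻ p in (Ωᶜ ×ˢ Ωᶜ)ᶜ, ENNReal.ofReal Λ * F p ∂(volume.prod volume) := by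
        refine lintegral_mono fun p => ?_
        rw [← ENNReal.ofReal_mul (by linarith)]
        apply ENNReal.ofReal_le_ofReal
        have h1 := hk p.1 p.2
        rw [← hνs, neg_sub] at h1
        calc (v p.1 - v p.2) ^ 2 * k p.1 p.2
            ≤ (v p.1 - v p.2) ^ 2 * (Λ * ν (p.1 - p.2)) := by gcongr
          _ = _ := by ring
    _ = ENNReal.ofReal Λ * ∫⁻ p in (Ωᶜ ×ˢ Ωᶜ)ᶜ, F p ∂(volume.prod volume) :=
        lintegral_const_mul' _ _ ENNReal.ofReal_ne_top
    _ ≤ _ := by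
        gcongr
        have hsub : ((Ωᶜ ×ˢ Ωᶜ)ᶜ : Set (EuclideanSpace ℝ (Fin d) × EuclideanSpace ℝ (Fin d)))
            ⊆ (Ω ×ˢ univ) ∪ (univ ×ˢ Ω) := by
          rintro ⟨x, y⟩ h
          simp only [mem_compl_iff, mem_prod, not_and_or, not_not] at h
          simpa using h
        refine (lintegral_mono_set hsub).trans ((lintegral_union_le _ _ _).trans ?_)
        rw [two_mul]
        refine add_le_add le_rfl (le_of_eq ?_)
        have h := (Measure.measurePreserving_swap
          (μ := (volume : Measure (EuclideanSpace ℝ (Fin d))))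
          (ν := (volume : Measure (EuclideanSpace ℝ (Fin d))))).setLIntegral_comp_preimage_emb
            MeasurableEquiv.prodComm.measurableEmbedding F (Ω ×ˢ univ)
        rw [← h]
        simp only [hFs]
        congr 2
        ext ⟨x, y⟩
        simp

theorem aux_memV_iff {d : ℕ} (Ω : Set (EuclideanSpace ℝ (Fin d)))
    (hΩ : MeasurableSet Ω)
    (ν : EuclideanSpace ℝ (Fin d) → ℝ)
    (hνs : ∀ h, ν (-h) = ν h)
    (k : EuclideanSpace ℝ (Fin d) → EuclideanSpace ℝ (Fin d) → ℝ)
    (hkm : Measurable (Function.uncurry k)) (hk0 : ∀ x y, 0 ≤ k x y)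
    (Λ : ℝ) (hΛ : 1 ≤ Λ)
    (hk : ∀ x y, Λ⁻¹ * ν (y - x) ≤ k x y ∧ k x y ≤ Λ * ν (y - x))
    (v : EuclideanSpace ℝ (Fin d) → ℝ) :
    MemV Ω ν v ↔ Measurable v ∧ MemLp v 2 (volume.restrict Ω) ∧ MemLp (auxD v) 2 (auxM Ω k) := by
  unfold MemV Vnorm2
  refine and_congr_right fun hv => ?_
  rw [aux_memLp hv, aux_memLp (auxD_meas hv), ENNReal.add_lt_top]
  refine and_congr_right fun _ => ⟨fun h => ?_, fun h => ?_⟩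
  · refine (aux_upper Ω ν hνs k hkm hk0 hΩ Λ hΛ (fun x y => (hk x y).2) v hv).trans_lt ?_
    exact ENNReal.mul_lt_top ENNReal.ofReal_lt_top (ENNReal.mul_lt_top (by simp) h)
  · refine (aux_lower Ω ν hνs k hkm hk0 Λ hΛ (fun x y => (hk x y).1) v hv).trans_lt ?_
    exact ENNReal.mul_lt_top ENNReal.ofReal_lt_top h

theorem aux_coer {d : ℕ} (Ω : Set (EuclideanSpace ℝ (Fin d)))
    (hΩ : MeasurableSet Ω)
    (ν : EuclideanSpace ℝ (Fin d) → ℝ)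
    (hνs : ∀ h, ν (-h) = ν h)
    (k : EuclideanSpace ℝ (Fin d) → EuclideanSpace ℝ (Fin d) → ℝ)
    (hkm : Measurable (Function.uncurry k)) (hk0 : ∀ x y, 0 ≤ k x y)
    (Λ : ℝ) (hΛ : 1 ≤ Λ)
    (hk : ∀ x y, Λ⁻¹ * ν (y - x) ≤ k x y ∧ k x y ≤ Λ * ν (y - x))
    (v : EuclideanSpace ℝ (Fin d) → ℝ) (hV : MemV Ω ν v) :
    (Vnorm2 Ω ν v).toReal ≤ (∫ x in Ω, (v x) ^ 2) + 2 * Λ * EForm Ω k v v := by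
  have hV' := (aux_memV_iff Ω hΩ ν hνs k hkm hk0 Λ hΛ hk v).1 hV
  obtain ⟨hv, h1, h2⟩ := hV'
  have hfin := ENNReal.add_lt_top.1 hV.2
  rw [Vnorm2, ENNReal.toReal_add hfin.1.ne hfin.2.ne, aux_EForm Ω k hkm hk0,
    integral_eq_lintegral_of_nonneg_ae (Eventually.of_forall fun x => sq_nonneg _)
      (hv.pow_const 2).aestronglyMeasurable]
  gcongr
  have h3 := aux_lower Ω ν hνs k hkm hk0 Λ hΛ (fun x y => (hk x y).1) v hv
  have h4 := ENNReal.toReal_mono (ENNReal.mul_lt_top ENNReal.ofReal_lt_top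
    ((aux_memLp (auxD_meas hv)).1 h2)).ne h3
  rw [ENNReal.toReal_mul, ENNReal.toReal_ofReal (by linarith),
    ← integral_eq_lintegral_of_nonneg_ae (Eventually.of_forall fun x => sq_nonneg _)
      ((auxD_meas hv).pow_const 2).aestronglyMeasurable] at h4
  refine h4.trans (le_of_eq ?_)
  simp only [← pow_two]
  ring

theorem auxM_ac {d : ℕ} (Ω : Set (EuclideanSpace ℝ (Fin d)))
    (k : EuclideanSpace ℝ (Fin d) → EuclideanSpace ℝ (Fin d) → ℝ) :
    auxM Ω k ≪ volume.prod volume :=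
  (withDensity_absolutelyContinuous _ _).trans Measure.absolutelyContinuous_restrict

theorem aux_limit {d : ℕ} (Ω : Set (EuclideanSpace ℝ (Fin d)))
    (hΩ0 : volume Ω ≠ 0)
    (k : EuclideanSpace ℝ (Fin d) → EuclideanSpace ℝ (Fin d) → ℝ)
    (hkm : Measurable (Function.uncurry k)) (hkpos : ∀ x y, x ≠ y → 0 < k x y)
    (v : ℕ → EuclideanSpace ℝ (Fin d) → ℝ) (hv : ∀ n, Measurable (v n))
    (w : EuclideanSpace ℝ (Fin d) × EuclideanSpace ℝ (Fin d) → ℝ)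
    (s : EuclideanSpace ℝ (Fin d) → ℝ)
    (hw : ∀ᵐ p ∂(auxM Ω k), Tendsto (fun n => auxD (v n) p) atTop (𝓝 (w p)))
    (hs : ∀ᵐ x ∂(volume.restrict Ω), Tendsto (fun n => v n x) atTop (𝓝 (s x))) :
    ∃ u, Measurable u ∧ u =ᵐ[volume.restrict Ω] s ∧ auxD u =ᵐ[auxM Ω k] w := by
  have hkm' : Measurable fun p : EuclideanSpace ℝ (Fin d) × EuclideanSpace ℝ (Fin d) =>
    ENNReal.ofReal (k p.1 p.2) := hkm.ennreal_ofReal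
  have h1 : ∀ᵐ p ∂(volume.prod volume).restrict (Ωᶜ ×ˢ Ωᶜ)ᶜ,
      ∃ l, Tendsto (fun n => auxD (v n) p) atTop (𝓝 l) := by
    have := (ae_withDensity_iff hkm').1 hw
    filter_upwards [this] with p hp
    by_cases h : p.1 = p.2
    · refine ⟨0, ?_⟩
      simp [auxD, h]
    · exact ⟨_, hp (by simpa using hkpos _ _ h)⟩
  have h2 : ∀ᵐ p ∂((volume.restrict Ω).prod volume),
      ∃ l, Tendsto (fun n => auxD (v n) p) atTop (𝓝 l) := by
    have e : (volume.restrict Ω).prod (volume : Measure (EuclideanSpace ℝ (Fin d))) =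
        (volume.prod volume).restrict (Ω ×ˢ univ) := by
      rw [← Measure.prod_restrict, Measure.restrict_univ]
    rw [e]
    refine ae_restrict_of_ae_restrict_of_subset ?_ h1
    rintro ⟨x, y⟩ ⟨hx, -⟩ ⟨hx', -⟩
    exact hx' hx
  have h3 := Measure.ae_ae_of_ae_prod h2
  have : NeBot (ae (volume.restrict Ω)) := by
    rw [ae_neBot]
    simpa [Measure.restrict_eq_zero] using hΩ0
  obtain ⟨x, hx1, hx2⟩ := (h3.and hs).exists
  have h4 : ∀ᵐ y, ∃ l, Tendsto (fun n => v n y) atTop (𝓝 l) := by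
    filter_upwards [hx1] with y hy
    obtain ⟨l, hl⟩ := hy
    refine ⟨s x - l, ?_⟩
    refine (hx2.sub hl).congr fun n => ?_
    simp [auxD]
  obtain ⟨u, hum, hu⟩ := measurable_limit_of_tendsto_metrizable_ae
    (fun n => (hv n).aemeasurable) h4
  refine ⟨u, hum, ?_, ?_⟩
  · filter_upwards [hs, ae_restrict_of_ae hu] with x h h'
    exact tendsto_nhds_unique h' h
  · have a1 : ∀ᵐ p ∂(auxM Ω k), Tendsto (fun n => v n p.1) atTop (𝓝 (u p.1)) :=
      (auxM_ac Ω k).ae_le (Measure.quasiMeasurePreserving_fst.ae hu)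
    have a2 : ∀ᵐ p ∂(auxM Ω k), Tendsto (fun n => v n p.2) atTop (𝓝 (u p.2)) :=
      (auxM_ac Ω k).ae_le (Measure.quasiMeasurePreserving_snd.ae hu)
    filter_upwards [a1, a2, hw] with p b1 b2 b3
    exact tendsto_nhds_unique (b1.sub b2) b3

theorem aux_norm_sq {α : Type*} [MeasurableSpace α] {μ : Measure α} {a b : α → ℝ}
    (ha : MemLp a 2 μ) (hb : MemLp b 2 μ) :
    inner ℝ (ha.toLp a) (hb.toLp b) = ∫ x, a x * b x ∂μ := by
  rw [L2.inner_def]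
  apply integral_congr_ae
  filter_upwards [ha.coeFn_toLp, hb.coeFn_toLp] with x h1 h2
  rw [h1, h2]
  simp [mul_comm]

/-- closedness of the range -/
theorem aux_closed {d : ℕ} (Ω : Set (EuclideanSpace ℝ (Fin d)))
    (hΩb : volume Ω ≠ ⊤)
    (k : EuclideanSpace ℝ (Fin d) → EuclideanSpace ℝ (Fin d) → ℝ)
    (hkm : Measurable (Function.uncurry k)) (hkpos : ∀ x y, x ≠ y → 0 < k x y)
    (V : Submodule ℝ (EuclideanSpace ℝ (Fin d) → ℝ))
    (hV : ∀ v, v ∈ V ↔ (Measurable v ∧ MemLp v 2 (volume.restrict Ω) ∧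
      MemLp (auxD v) 2 (auxM Ω k)) ∧ ∫ x in Ω, v x = 0)
    (S : V →ₗ[ℝ] Lp ℝ 2 (volume.restrict Ω))
    (hS : ∀ v, S v =ᵐ[volume.restrict Ω] v.1)
    (T : V →ₗ[ℝ] Lp ℝ 2 (auxM Ω k))
    (hT : ∀ v, T v =ᵐ[auxM Ω k] auxD v.1)
    (K : ℝ) (hST : ∀ v, ‖S v‖ ≤ K * ‖T v‖) :
    IsClosed (LinearMap.range T : Set (Lp ℝ 2 (auxM Ω k))) := by
  have : IsFiniteMeasure (volume.restrict Ω) := ⟨by simpa using hΩb.lt_top⟩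
  by_cases hΩ0 : volume Ω = 0
  · have hm : auxM Ω k = 0 := by
      have h0 : (volume.prod volume).restrict ((Ωᶜ ×ˢ Ωᶜ)ᶜ :
          Set (EuclideanSpace ℝ (Fin d) × EuclideanSpace ℝ (Fin d))) = 0 := by
        rw [Measure.restrict_eq_zero]
        have hsub : ((Ωᶜ ×ˢ Ωᶜ)ᶜ : Set (EuclideanSpace ℝ (Fin d) × EuclideanSpace ℝ (Fin d)))
            ⊆ (Ω ×ˢ univ) ∪ (univ ×ˢ Ω) := by
          rintro ⟨x, y⟩ h
          simp only [mem_compl_iff, mem_prod, not_and_or, not_not] at h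
          simpa using h
        refine measure_mono_null hsub (measure_union_null ?_ ?_) <;>
          rw [Measure.prod_prod, hΩ0] <;> simp
      rw [auxM, h0]; simp
    have : (LinearMap.range T : Set (Lp ℝ 2 (auxM Ω k))) = univ := by
      apply eq_univ_of_forall
      intro w
      refine ⟨0, ?_⟩
      apply Lp.ext
      have hu : (auxM Ω k) univ = 0 := by rw [hm]; rfl
      exact measure_mono_null (subset_univ _) hu
    rw [this]; exact isClosed_univ
  rw [← isSeqClosed_iff_isClosed]
  intro z w hz hzw
  choose v hv using hz
  have hSc : CauchySeq fun n => S (v n) := by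
    have hc : CauchySeq z := hzw.cauchySeq
    have hK : ∀ a b, dist (S (v a)) (S (v b)) ≤ |K| * dist (z a) (z b) := by
      intro a b
      rw [dist_eq_norm, dist_eq_norm, ← map_sub, ← hv a, ← hv b, ← map_sub]
      exact (hST _).trans (by gcongr; exact le_abs_self K)
    rw [Metric.cauchySeq_iff] at hc ⊢
    intro ε hε
    obtain ⟨N, hN⟩ := hc (ε / (|K| + 1)) (by positivity)
    refine ⟨N, fun a ha b hb => (hK a b).trans_lt ?_⟩
    have := hN a ha b hb
    rw [lt_div_iff₀ (by positivity)] at this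
    nlinarith [dist_nonneg (x := z a) (y := z b)]
  obtain ⟨s, hs⟩ := cauchySeq_tendsto_of_complete hSc
  obtain ⟨n1, hn1, ht1⟩ := (tendstoInMeasure_of_tendsto_Lp hs).exists_seq_tendsto_ae
  obtain ⟨n2, hn2, ht2⟩ := (tendstoInMeasure_of_tendsto_Lp
    (hzw.comp hn1.tendsto_atTop)).exists_seq_tendsto_ae
  obtain ⟨u, hum, hus, huw⟩ := aux_limit Ω hΩ0 k hkm hkpos
    (fun i => (v (n1 (n2 i))).1) (fun i => ((hV _).1 (v _).2).1.1) w s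
    (by
      have : ∀ᵐ p ∂(auxM Ω k), ∀ n, T (v n) p = auxD (v n).1 p := ae_all_iff.2 fun n => hT _
      filter_upwards [ht2, this] with p h1 h2
      refine h1.congr fun n => ?_
      rw [← h2, hv]; rfl)
    (by
      have : ∀ᵐ p ∂(volume.restrict Ω), ∀ n, S (v n) p = (v n).1 p := ae_all_iff.2 fun n => hS _
      filter_upwards [ht1, this] with p h1 h2
      refine (h1.comp hn2.tendsto_atTop).congr fun n => ?_
      simp [← h2])
  have huV : u ∈ V := by
    refine (hV u).2 ⟨⟨hum, (memLp_congr_ae hus).2 (Lp.memLp s),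
      (memLp_congr_ae huw).2 (Lp.memLp w)⟩, ?_⟩
    rw [integral_congr_ae hus]
    have h1 : MemLp (fun _ : EuclideanSpace ℝ (Fin d) => (1 : ℝ)) 2 (volume.restrict Ω) :=
      memLp_const 1
    have hi : ∀ y : Lp ℝ 2 (volume.restrict Ω), inner ℝ (h1.toLp _) y = ∫ x in Ω, y x := by
      intro y
      rw [L2.inner_def]
      apply integral_congr_ae
      filter_upwards [h1.coeFn_toLp] with x h
      rw [h]; simp
    have ht : Tendsto (fun n => inner ℝ (h1.toLp _) (S (v n))) atTop
        (𝓝 (inner ℝ (h1.toLp _) s)) := tendsto_const_nhds.inner hs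
    rw [← hi]
    refine tendsto_nhds_unique ht ?_
    have : ∀ n, inner ℝ (h1.toLp _) (S (v n)) = (0 : ℝ) := fun n => by
      rw [hi, integral_congr_ae (hS _)]
      exact ((hV _).1 (v n).2).2
    exact tendsto_const_nhds.congr fun n => (this n).symm
  exact ⟨⟨u, huV⟩, Lp.ext ((hT _).trans huw)⟩

/-- well-posedness of the inhomogeneous Neumann problem on the
mean-zero subspace `V_ν(Ω|ℝ^d)^⊥`, for data `f ∈ V_ν(Ω|ℝ^d)'` and
`g ∈ T_ν(Ω^c)'` (encoded as bounded linear functionals, `g` factoring through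
restriction to `Ω^c`), via the Lax–Milgram lemma. -/
theorem neumann_wellposedness_meanzero
    (d : ℕ) (Ω : Set (EuclideanSpace ℝ (Fin d)))
    (hΩo : IsOpen Ω) (hΩb : Bornology.IsBounded Ω)
    (ν : EuclideanSpace ℝ (Fin d) → ℝ)
    (hν0 : ∀ h, 0 ≤ ν h) (hνm : Measurable ν) (hνs : ∀ h, ν (-h) = ν h)
    (hlevy : Integrable (fun h => min 1 (‖h‖ ^ 2) * ν h))
    (hsupp : ∀ h, h ≠ 0 → 0 < ν h)
    (k : EuclideanSpace ℝ (Fin d) → EuclideanSpace ℝ (Fin d) → ℝ)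
    (hkm : Measurable (Function.uncurry k)) (hks : ∀ x y, k x y = k y x)
    (Λ : ℝ) (hΛ : 1 ≤ Λ)
    (hk : ∀ x y, Λ⁻¹ * ν (y - x) ≤ k x y ∧ k x y ≤ Λ * ν (y - x))
    (C₀ : ℝ) (hC₀ : 0 < C₀)
    (hPoin : ∀ v, MemV Ω ν v → (∫ x in Ω, v x) = 0 →
      (∫ x in Ω, (v x) ^ 2) ≤ C₀ * EForm Ω k v v) :
    ∃ C : ℝ, 0 < C ∧
      ∀ (f g : (EuclideanSpace ℝ (Fin d) → ℝ) → ℝ) (Cf Cg : ℝ),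
        (∀ v w, MemV Ω ν v → MemV Ω ν w → f (v + w) = f v + f w) →
        (∀ (a : ℝ) v, MemV Ω ν v → f (a • v) = a * f v) →
        (∀ v, MemV Ω ν v → |f v| ≤ Cf * Real.sqrt (Vnorm2 Ω ν v).toReal) →
        (∀ v w, MemV Ω ν v → MemV Ω ν w → g (v + w) = g v + g w) →
        (∀ (a : ℝ) v, MemV Ω ν v → g (a • v) = a * g v) →
        (∀ v w, (∀ x ∉ Ω, v x = w x) → g v = g w) →
        (∀ v, MemV Ω ν v → |g v| ≤ Cg * Real.sqrt (Vnorm2 Ω ν v).toReal) →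
        ∃ u, MemV Ω ν u ∧ (∫ x in Ω, u x) = 0 ∧
          (∀ v, MemV Ω ν v → (∫ x in Ω, v x) = 0 → EForm Ω k u v = f v + g v) ∧
          (Vnorm2 Ω ν u).toReal ≤ (C * (Cf + Cg)) ^ 2 ∧
          (∀ u', MemV Ω ν u' → (∫ x in Ω, u' x) = 0 →
            (∀ v, MemV Ω ν v → (∫ x in Ω, v x) = 0 → EForm Ω k u' v = f v + g v) →
            Vnorm2 Ω ν (u' - u) = 0) := by
  have hΩm : MeasurableSet Ω := hΩo.measurableSet
  have hΛ0 : 0 < Λ := by linarith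
  have hk0 : ∀ x y, 0 ≤ k x y := fun x y =>
    le_trans (mul_nonneg (inv_nonneg.2 hΛ0.le) (hν0 _)) (hk x y).1
  have hkpos : ∀ x y, x ≠ y → 0 < k x y := fun x y hxy =>
    lt_of_lt_of_le (mul_pos (inv_pos.2 hΛ0) (hsupp _ (sub_ne_zero.2 hxy.symm))) (hk x y).1
  have hΩv : volume Ω ≠ ⊤ := hΩb.measure_lt_top.ne
  have hfm : IsFiniteMeasure (volume.restrict Ω) := ⟨by simpa using hΩv.lt_top⟩
  have hiff := aux_memV_iff Ω hΩm ν hνs k hkm hk0 Λ hΛ hk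
  have hcoer := aux_coer Ω hΩm ν hνs k hkm hk0 Λ hΛ hk
  have hint : ∀ v, MemV Ω ν v → Integrable v (volume.restrict Ω) := fun v hv =>
    ((hiff v).1 hv).2.1.integrable (by norm_num)
  have hadd : ∀ v w, MemV Ω ν v → MemV Ω ν w → MemV Ω ν (v + w) := by
    intro v w hv hw
    rw [hiff] at hv hw ⊢
    have e : auxD (v + w) = auxD v + auxD w := by
      ext p; simp only [auxD, Pi.add_apply]; ring
    rw [e]
    exact ⟨hv.1.add hw.1, hv.2.1.add hw.2.1, hv.2.2.add hw.2.2⟩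
  have hsmul : ∀ (a : ℝ) v, MemV Ω ν v → MemV Ω ν (a • v) := by
    intro a v hv
    rw [hiff] at hv ⊢
    have e : auxD (a • v) = a • auxD v := by
      ext p; simp only [auxD, Pi.smul_apply, smul_eq_mul]; ring
    rw [e]
    exact ⟨hv.1.const_smul a, hv.2.1.const_smul a, hv.2.2.const_smul a⟩
  have hzero : MemV Ω ν 0 := by
    rw [hiff]
    have e : auxD (0 : EuclideanSpace ℝ (Fin d) → ℝ) = 0 := by
      ext p; simp [auxD]
    rw [e]
    exact ⟨measurable_const, MemLp.zero, MemLp.zero⟩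
  let V : Submodule ℝ (EuclideanSpace ℝ (Fin d) → ℝ) :=
    { carrier := {v | MemV Ω ν v ∧ ∫ x in Ω, v x = 0}
      add_mem' := by
        rintro v w ⟨hv, hv'⟩ ⟨hw, hw'⟩
        refine ⟨hadd v w hv hw, ?_⟩
        simp only [Pi.add_apply]
        rw [integral_add (hint v hv) (hint w hw), hv', hw', add_zero]
      zero_mem' := ⟨hzero, by simp⟩
      smul_mem' := by
        rintro a v ⟨hv, hv'⟩
        refine ⟨hsmul a v hv, ?_⟩
        simp only [Pi.smul_apply]
        rw [integral_smul, hv', smul_zero] }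
  have hVm : ∀ v : V, MemV Ω ν v.1 := fun v => v.2.1
  let S : V →ₗ[ℝ] Lp ℝ 2 (volume.restrict Ω) :=
    { toFun := fun v => ((hiff v.1).1 (hVm v)).2.1.toLp v.1
      map_add' := fun v w => MemLp.toLp_add _ _
      map_smul' := fun a v => MemLp.toLp_const_smul a _ }
  let T : V →ₗ[ℝ] Lp ℝ 2 (auxM Ω k) :=
    { toFun := fun v => ((hiff v.1).1 (hVm v)).2.2.toLp (auxD v.1)
      map_add' := fun v w => by
        rw [← MemLp.toLp_add]
        congr 1
        ext p; simp only [auxD, Pi.add_apply, Submodule.coe_add]; ring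
      map_smul' := fun a v => by
        rw [RingHom.id_apply, ← MemLp.toLp_const_smul]
        congr 1
        ext p; simp only [auxD, Pi.smul_apply, Submodule.coe_smul, smul_eq_mul]; ring }
  have hS : ∀ v, S v =ᵐ[volume.restrict Ω] v.1 := fun v => MemLp.coeFn_toLp ((hiff v.1).1 (hVm v)).2.1
  have hT : ∀ v, T v =ᵐ[auxM Ω k] auxD v.1 := fun v => MemLp.coeFn_toLp ((hiff v.1).1 (hVm v)).2.2
  have hET : ∀ u v : V, EForm Ω k u.1 v.1 = (1 / 2) * inner ℝ (T u) (T v) := by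
    intro u v
    rw [aux_EForm Ω k hkm hk0]
    congr 1
    exact (aux_norm_sq ((hiff u.1).1 (hVm u)).2.2 ((hiff v.1).1 (hVm v)).2.2).symm
  have hETn : ∀ v : V, EForm Ω k v.1 v.1 = (1 / 2) * ‖T v‖ ^ 2 := by
    intro v
    rw [hET, real_inner_self_eq_norm_sq]
  have hSn : ∀ v : V, ‖S v‖ ^ 2 = ∫ x in Ω, (v.1 x) ^ 2 := by
    intro v
    rw [← real_inner_self_eq_norm_sq]
    refine (aux_norm_sq ((hiff v.1).1 (hVm v)).2.1 ((hiff v.1).1 (hVm v)).2.1).trans ?_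
    simp only [pow_two]
  have hST : ∀ v, ‖S v‖ ≤ Real.sqrt C₀ * ‖T v‖ := by
    intro v
    have h := hPoin v.1 v.2.1 v.2.2
    rw [← hSn, hETn] at h
    refine abs_le_of_sq_le_sq' ?_ (by positivity) |>.2
    rw [mul_pow, Real.sq_sqrt hC₀.le]
    nlinarith [sq_nonneg ‖T v‖]
  have hclosed := aux_closed Ω hΩv k hkm hkpos V
    (fun v => and_congr_left fun _ => hiff v) S hS T hT _ hST
  set K := C₀ + 2 * Λ with hK
  have hKpos : 0 < K := by positivity
  have hVK : ∀ v : V, (Vnorm2 Ω ν v.1).toReal ≤ K * EForm Ω k v.1 v.1 := by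
    intro v
    have h1 := hcoer v.1 v.2.1
    have h2 := hPoin v.1 v.2.1 v.2.2
    rw [hK]; linarith
  refine ⟨K, hKpos, ?_⟩
  intro f g Cf Cg hfa hfs hfb hga hgs _ hgb
  let l : V →ₗ[ℝ] ℝ :=
    { toFun := fun v => f v.1 + g v.1
      map_add' := fun v w => by
        rw [Submodule.coe_add, hfa _ _ v.2.1 w.2.1, hga _ _ v.2.1 w.2.1]; ring
      map_smul' := fun a v => by
        rw [Submodule.coe_smul, hfs _ _ v.2.1, hgs _ _ v.2.1, RingHom.id_apply, smul_eq_mul]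
        ring }
  have hlb : ∀ v : V, |l v| ≤ (Cf + Cg) * Real.sqrt (Vnorm2 Ω ν v.1).toReal := by
    intro v
    have h1 := hfb v.1 v.2.1
    have h2 := hgb v.1 v.2.1
    have h3 : |l v| ≤ |f v.1| + |g v.1| := abs_add_le _ _
    linarith
  obtain ⟨u, hu⟩ := aux_riesz T hclosed ((2 : ℝ) • l) (2 * (|Cf + Cg| * Real.sqrt K)) (by
    intro v
    rw [LinearMap.smul_apply, smul_eq_mul, abs_mul, abs_two, mul_assoc, mul_assoc]
    refine mul_le_mul_of_nonneg_left ((hlb v).trans ?_) (by norm_num)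
    refine mul_le_mul (le_abs_self _) ?_ (Real.sqrt_nonneg _) (abs_nonneg _)
    have h1 := hVK v
    rw [hETn] at h1
    refine Real.sqrt_le_iff.2 ⟨by positivity, ?_⟩
    rw [mul_pow, Real.sq_sqrt hKpos.le]
    nlinarith [mul_nonneg hKpos.le (sq_nonneg ‖T v‖)])
  have hul : ∀ v : V, EForm Ω k u.1 v.1 = l v := by
    intro v
    rw [hET, hu, LinearMap.smul_apply, smul_eq_mul]; ring
  refine ⟨u.1, u.2.1, u.2.2, fun v hv hv' => hul ⟨v, hv, hv'⟩, ?_, ?_⟩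
  · set N := (Vnorm2 Ω ν u.1).toReal with hN
    have hN0 : 0 ≤ N := ENNReal.toReal_nonneg
    have h1 : N ≤ K * ((Cf + Cg) * Real.sqrt N) := by
      refine (hVK u).trans (mul_le_mul_of_nonneg_left ?_ hKpos.le)
      rw [hul]
      exact (le_abs_self _).trans (hlb u)
    rcases hN0.eq_or_lt with h0 | h0
    · rw [← h0]; positivity
    · have hs : 0 < Real.sqrt N := Real.sqrt_pos.2 h0
      have h2 : Real.sqrt N ≤ K * (Cf + Cg) := by
        refine le_of_mul_le_mul_right ?_ hs
        rw [Real.mul_self_sqrt hN0]; linarith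
      calc N = Real.sqrt N ^ 2 := (Real.sq_sqrt hN0).symm
        _ ≤ _ := by gcongr
  · intro u' hu' hu0 hu'l
    let w : V := ⟨u', hu', hu0⟩
    have h1 : ∀ v : V, EForm Ω k w.1 v.1 = l v := fun v => hu'l v.1 v.2.1 v.2.2
    have h2 : EForm Ω k (w - u).1 (w - u).1 = 0 := by
      have a := h1 (w - u)
      have b := hul (w - u)
      rw [hET] at a b ⊢
      rw [map_sub T w u] at a b ⊢
      rw [inner_sub_left]
      linarith
    have h3 := hVK (w - u)
    rw [h2, mul_zero] at h3
    have h4 := le_antisymm h3 ENNReal.toReal_nonneg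
    rcases (ENNReal.toReal_eq_zero_iff _).1 h4 with h | h
    · exact h
    · exact absurd h (w - u).2.1.2.ne
end

section
/- Under the assumptions of the well-posed Neumann problem (Ω open bounded, ν a Lévy density with full support and valid Poincaré inequality on the mean-zero subspace), the inhomogeneous variational Neumann problem E(u,v) = ⟨f,v⟩ + ⟨g,v⟩ for all v ∈ V_ν(Ω|ℝ^d) is solvable if and only if ⟨f,1⟩ + ⟨g,1⟩ = 0; in that case all solutions are of the form u₀ + c with c ∈ ℝ, where u₀ is the unique mean-zero solution. -/
open MeasureTheory Set Metric ENNReal NNReal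

/-- The difference function. -/
def dlt {X : Type*} (u : X → ℝ) : X × X → ℝ := fun p => u p.1 - u p.2

/-- The measure with density `k` on the complement of `Ωᶜ × Ωᶜ`. -/
noncomputable def kMeas {d : ℕ} (Ω : Set (EuclideanSpace ℝ (Fin d)))
    (k : EuclideanSpace ℝ (Fin d) → EuclideanSpace ℝ (Fin d) → ℝ) :
    Measure (EuclideanSpace ℝ (Fin d) × EuclideanSpace ℝ (Fin d)) :=
  ((volume.prod volume).restrict (Ωᶜ ×ˢ Ωᶜ)ᶜ).withDensity
    (fun p => ENNReal.ofReal (k p.1 p.2))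

lemma inner_toLp_two {α : Type*} [MeasurableSpace α] {m : Measure α} {a b : α → ℝ}
    (ha : MemLp a 2 m) (hb : MemLp b 2 m) :
    inner ℝ (ha.toLp a) (hb.toLp b) = ∫ x, a x * b x ∂m := by
  rw [MeasureTheory.L2.inner_def]
  apply integral_congr_ae
  filter_upwards [ha.coeFn_toLp, hb.coeFn_toLp] with x hx hy
  rw [hx, hy]
  simp [mul_comm]

lemma norm_sq_toLp_two {α : Type*} [MeasurableSpace α] {m : Measure α} {a : α → ℝ}
    (ha : MemLp a 2 m) : ‖ha.toLp a‖ ^ 2 = ∫ x, a x ^ 2 ∂m := by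
  rw [← real_inner_self_eq_norm_sq, inner_toLp_two]
  simp [sq]

lemma exists_subseq_ae {α : Type*} [MeasurableSpace α] {m : Measure α} {a : ℕ → α → ℝ}
    (ha : ∀ n, MemLp (a n) 2 m) (h : Lp ℝ 2 m)
    (hl : Filter.Tendsto (fun n => (ha n).toLp (a n)) Filter.atTop (nhds h)) :
    ∃ ns : ℕ → ℕ, StrictMono ns ∧
      ∀ᵐ x ∂m, Filter.Tendsto (fun i => a (ns i) x) Filter.atTop (nhds (h x)) := by
  obtain ⟨ns, hns, hae⟩ := (tendstoInMeasure_of_tendsto_Lp hl).exists_seq_tendsto_ae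
  refine ⟨ns, hns, ?_⟩
  have := ae_all_iff.2 (fun n => (ha n).coeFn_toLp)
  filter_upwards [hae, this] with x hx hx2
  simpa [hx2] using hx

/-- Riesz representation through a linear map, with the representative in the closure of
the range. -/
lemma riesz_closure {V H : Type*} [AddCommGroup V] [Module ℝ V] [NormedAddCommGroup H]
    [InnerProductSpace ℝ H] [CompleteSpace H] (J : V →ₗ[ℝ] H) (F : V →ₗ[ℝ] ℝ) (C : ℝ)
    (hC : ∀ v, |F v| ≤ C * ‖J v‖) :
    ∃ w : ℕ → V, ∃ h : H, Filter.Tendsto (fun n => J (w n)) Filter.atTop (nhds h) ∧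
      ∀ v, inner ℝ h (J v) = F v := by
  obtain ⟨s, hs⟩ := J.rangeRestrict.exists_rightInverse_of_surjective
    (LinearMap.range_rangeRestrict J)
  have hs' : ∀ r : LinearMap.range J, J (s r) = r := fun r => by
    have := congrArg (fun L => ((L r : LinearMap.range J) : H)) hs
    simpa using this
  let φ : LinearMap.range J →L[ℝ] ℝ := (F.comp s).mkContinuous C (fun r => by
    have := hC (s r)
    rw [hs'] at this
    simpa using this)
  obtain ⟨g, hg, -⟩ := exists_extension_norm_eq (LinearMap.range J) φ
  have hgF : ∀ v, g (J v) = F v := fun v => by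
    have h1 := hg ⟨J v, LinearMap.mem_range_self J v⟩
    have h2 : φ ⟨J v, LinearMap.mem_range_self J v⟩
      = F (s ⟨J v, LinearMap.mem_range_self J v⟩) := rfl
    have h3 := hC (s ⟨J v, LinearMap.mem_range_self J v⟩ - v)
    rw [map_sub, map_sub, hs', sub_self, norm_zero, mul_zero] at h3
    have h4 := abs_nonpos_iff.1 h3
    simp only at h1
    rw [h1, h2]
    linarith
  let K := (LinearMap.range J).topologicalClosure
  have : CompleteSpace K := (LinearMap.range J).isClosed_topologicalClosure.completeSpace_coe
  let h' := (InnerProductSpace.toDual ℝ H).symm g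
  let h : K := K.orthogonalProjectionOnto h'
  have hcl : (h : H) ∈ closure (LinearMap.range J : Set H) := h.2
  obtain ⟨x, hx, hxl⟩ := mem_closure_iff_seq_limit.1 hcl
  choose w hw using hx
  refine ⟨w, h, by simpa [hw] using hxl, fun v => ?_⟩
  have hm : J v ∈ K := (LinearMap.range J).le_topologicalClosure (LinearMap.mem_range_self J v)
  rw [← hgF]
  have e1 : inner ℝ (h : H) (J v) = inner ℝ h' (J v) := by
    have := Submodule.inner_orthogonalProjectionOnto_eq_of_mem_right (K := K) ⟨J v, hm⟩ h'
    exact this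
  rw [e1]
  simp [h']

section
variable {d : ℕ} {Ω : Set (EuclideanSpace ℝ (Fin d))}
    {ν : EuclideanSpace ℝ (Fin d) → ℝ}
    {k : EuclideanSpace ℝ (Fin d) → EuclideanSpace ℝ (Fin d) → ℝ} {Λ : ℝ}

lemma measurable_dlt {u : EuclideanSpace ℝ (Fin d) → ℝ} (hu : Measurable u) :
    Measurable (dlt u) :=
  (hu.comp measurable_fst).sub (hu.comp measurable_snd)

lemma k_nonneg (hν0 : ∀ h, 0 ≤ ν h) (hΛ : 1 ≤ Λ)
    (hk : ∀ x y, Λ⁻¹ * ν (y - x) ≤ k x y ∧ k x y ≤ Λ * ν (y - x)) (x y) : 0 ≤ k x y :=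
  le_trans (mul_nonneg (by positivity) (hν0 _)) (hk x y).1

lemma EForm_eq (hk0 : ∀ x y, 0 ≤ k x y) (hkm : Measurable (Function.uncurry k))
    (u v : EuclideanSpace ℝ (Fin d) → ℝ) :
    EForm Ω k u v = (1 / 2) * ∫ p, dlt u p * dlt v p ∂(kMeas Ω k) := by
  unfold EForm kMeas
  have hm : Measurable fun p : EuclideanSpace ℝ (Fin d) × EuclideanSpace ℝ (Fin d) =>
    ENNReal.ofReal (k p.1 p.2) := hkm.ennreal_ofReal
  rw [integral_withDensity_eq_integral_toReal_smul hm (by simp)]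
  congr 1
  apply integral_congr_ae
  filter_upwards with p
  rw [ENNReal.toReal_ofReal (hk0 _ _)]
  simp [dlt, mul_comm]

lemma lint_kMeas (hkm : Measurable (Function.uncurry k))
    {u : EuclideanSpace ℝ (Fin d) → ℝ} (hu : Measurable u) (hk0 : ∀ x y, 0 ≤ k x y) :
    ∫⁻ p, ENNReal.ofReal (dlt u p ^ 2) ∂(kMeas Ω k) =
      ∫⁻ p in (Ωᶜ ×ˢ Ωᶜ)ᶜ, ENNReal.ofReal ((u p.1 - u p.2) ^ 2 * k p.1 p.2)
        ∂(volume.prod volume) := by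
  unfold kMeas
  have hm : Measurable fun p : EuclideanSpace ℝ (Fin d) × EuclideanSpace ℝ (Fin d) =>
    ENNReal.ofReal (k p.1 p.2) := hkm.ennreal_ofReal
  rw [lintegral_withDensity_eq_lintegral_mul _ hm ((measurable_dlt hu).pow_const 2).ennreal_ofReal]
  apply lintegral_congr
  intro p
  simp only [Pi.mul_apply, dlt]
  rw [← ENNReal.ofReal_mul (hk0 _ _), mul_comm]

lemma lemA (hΩ : MeasurableSet Ω) (hν0 : ∀ h, 0 ≤ ν h) (hνs : ∀ h, ν (-h) = ν h)
    (hνm : Measurable ν)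
    (hkm : Measurable (Function.uncurry k)) (hΛ : 1 ≤ Λ)
    (hk : ∀ x y, Λ⁻¹ * ν (y - x) ≤ k x y ∧ k x y ≤ Λ * ν (y - x))
    {u : EuclideanSpace ℝ (Fin d) → ℝ} (hu : Measurable u) :
    ∫⁻ p, ENNReal.ofReal (dlt u p ^ 2) ∂(kMeas Ω k) ≤
      ENNReal.ofReal (2 * Λ) * ∫⁻ p in Ω ×ˢ univ,
        ENNReal.ofReal ((u p.1 - u p.2) ^ 2 * ν (p.1 - p.2)) ∂(volume.prod volume) := by
  have hk0 := k_nonneg hν0 hΛ hk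
  have hν' : ∀ x y, ν (x - y) = ν (y - x) := fun x y => by rw [← hνs, neg_sub]
  rw [lint_kMeas hkm hu hk0]
  set G : EuclideanSpace ℝ (Fin d) × EuclideanSpace ℝ (Fin d) → ℝ≥0∞ :=
    fun p => ENNReal.ofReal ((u p.1 - u p.2) ^ 2 * ν (p.1 - p.2)) with hG
  have hGm : Measurable G := (((measurable_dlt hu).pow_const 2).mul
    (hνm.comp (measurable_fst.sub measurable_snd))).ennreal_ofReal
  have hset : (Ωᶜ ×ˢ Ωᶜ)ᶜ ⊆ (Ω ×ˢ univ) ∪ (univ ×ˢ Ω) := by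
    rintro ⟨x, y⟩ h
    simp at h ⊢
    tauto
  have hswap : ∫⁻ p in univ ×ˢ Ω, G p ∂(volume.prod volume)
      = ∫⁻ p in Ω ×ˢ univ, G p ∂(volume.prod volume) := by
    have := (Measure.measurePreserving_swap (μ := (volume : Measure (EuclideanSpace ℝ (Fin d))))
      (ν := (volume : Measure (EuclideanSpace ℝ (Fin d))))).setLIntegral_comp_preimage
      (s := Ω ×ˢ univ) (hΩ.prod MeasurableSet.univ) hGm
    have e' : (Prod.swap ⁻¹' (Ω ×ˢ univ) : Set (EuclideanSpace ℝ (Fin d) × EuclideanSpace ℝ (Fin d)))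
      = univ ×ˢ Ω := by
      ext ⟨x, y⟩; simp
    rw [← this, e']
    apply lintegral_congr
    rintro ⟨x, y⟩
    simp only [hG, Prod.swap]
    rw [hν' x y]
    congr 2
    ring
  calc _ ≤ ∫⁻ p in (Ωᶜ ×ˢ Ωᶜ)ᶜ, ENNReal.ofReal Λ * G p ∂(volume.prod volume) := by
        apply lintegral_mono
        intro p
        simp only [hG]
        rw [← ENNReal.ofReal_mul (by positivity)]
        apply ENNReal.ofReal_le_ofReal
        have := (hk p.1 p.2).2
        rw [hν' p.1 p.2]
        nlinarith [mul_le_mul_of_nonneg_left this (sq_nonneg (u p.1 - u p.2))]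
    _ = ENNReal.ofReal Λ * ∫⁻ p in (Ωᶜ ×ˢ Ωᶜ)ᶜ, G p ∂(volume.prod volume) :=
        lintegral_const_mul _ hGm
    _ ≤ ENNReal.ofReal Λ * (∫⁻ p in Ω ×ˢ univ, G p ∂(volume.prod volume)
          + ∫⁻ p in univ ×ˢ Ω, G p ∂(volume.prod volume)) := by
        gcongr
        exact (lintegral_mono_set hset).trans (lintegral_union_le _ _ _)
    _ = _ := by
        rw [hswap, ENNReal.ofReal_mul (by norm_num), ← two_mul, ENNReal.ofReal_ofNat]
        ring

lemma lemB (hν0 : ∀ h, 0 ≤ ν h) (hνs : ∀ h, ν (-h) = ν h)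
    (hkm : Measurable (Function.uncurry k)) (hΛ : 1 ≤ Λ)
    (hk : ∀ x y, Λ⁻¹ * ν (y - x) ≤ k x y ∧ k x y ≤ Λ * ν (y - x))
    {u : EuclideanSpace ℝ (Fin d) → ℝ} (hu : Measurable u) :
    ∫⁻ p in Ω ×ˢ univ,
        ENNReal.ofReal ((u p.1 - u p.2) ^ 2 * ν (p.1 - p.2)) ∂(volume.prod volume) ≤
    ENNReal.ofReal Λ * ∫⁻ p, ENNReal.ofReal (dlt u p ^ 2) ∂(kMeas Ω k) := by
  have hk0 := k_nonneg hν0 hΛ hk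
  have hν' : ∀ x y, ν (x - y) = ν (y - x) := fun x y => by rw [← hνs, neg_sub]
  have hΛ0 : 0 < Λ := by linarith
  have hm2 : Measurable fun p : EuclideanSpace ℝ (Fin d) × EuclideanSpace ℝ (Fin d) =>
      ENNReal.ofReal ((u p.1 - u p.2) ^ 2 * k p.1 p.2) :=
    (((measurable_dlt hu).pow_const 2).mul hkm).ennreal_ofReal
  rw [lint_kMeas hkm hu hk0, ← lintegral_const_mul _ hm2]
  have hset : (Ω ×ˢ univ) ⊆ (Ωᶜ ×ˢ Ωᶜ)ᶜ := by
    rintro ⟨x, y⟩ h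
    simp at h ⊢
    tauto
  refine (lintegral_mono_set hset).trans (lintegral_mono fun p => ?_)
  rw [← ENNReal.ofReal_mul hΛ0.le]
  apply ENNReal.ofReal_le_ofReal
  have := (hk p.1 p.2).1
  rw [hν' p.1 p.2]
  rw [inv_mul_le_iff₀ hΛ0] at this
  nlinarith [mul_le_mul_of_nonneg_left this (sq_nonneg (u p.1 - u p.2))]

lemma memLp_two_iff_lint {α : Type*} [MeasurableSpace α] {m : Measure α} {a : α → ℝ}
    (ha : Measurable a) : MemLp a 2 m ↔ ∫⁻ x, ENNReal.ofReal (a x ^ 2) ∂m < ⊤ := by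
  rw [memLp_two_iff_integrable_sq ha.aestronglyMeasurable,
    ← hasFiniteIntegral_iff_ofReal (Filter.Eventually.of_forall fun x => sq_nonneg (a x))]
  exact ⟨fun h => h.2, fun h => ⟨(ha.pow_const 2).aestronglyMeasurable, h⟩⟩

lemma memV_iff (hΩ : MeasurableSet Ω) (hν0 : ∀ h, 0 ≤ ν h) (hνs : ∀ h, ν (-h) = ν h)
    (hνm : Measurable ν)
    (hkm : Measurable (Function.uncurry k)) (hΛ : 1 ≤ Λ)
    (hk : ∀ x y, Λ⁻¹ * ν (y - x) ≤ k x y ∧ k x y ≤ Λ * ν (y - x))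
    {u : EuclideanSpace ℝ (Fin d) → ℝ} :
    MemV Ω ν u ↔ Measurable u ∧ MemLp u 2 (volume.restrict Ω) ∧ MemLp (dlt u) 2 (kMeas Ω k) := by
  unfold MemV Vnorm2
  refine and_congr_right fun hu => ?_
  rw [memLp_two_iff_lint hu, memLp_two_iff_lint (measurable_dlt hu), ENNReal.add_lt_top]
  refine and_congr_right fun _ => ⟨fun h => ?_, fun h => ?_⟩
  · exact (lemA hΩ hν0 hνs hνm hkm hΛ hk hu).trans_lt (ENNReal.mul_lt_top ENNReal.ofReal_lt_top h)
  · exact (lemB hν0 hνs hkm hΛ hk hu).trans_lt (ENNReal.mul_lt_top ENNReal.ofReal_lt_top h)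

lemma Vnorm2_le (hΩ : MeasurableSet Ω) (hν0 : ∀ h, 0 ≤ ν h) (hνs : ∀ h, ν (-h) = ν h)
    (hνm : Measurable ν)
    (hkm : Measurable (Function.uncurry k)) (hΛ : 1 ≤ Λ)
    (hk : ∀ x y, Λ⁻¹ * ν (y - x) ≤ k x y ∧ k x y ≤ Λ * ν (y - x))
    {u : EuclideanSpace ℝ (Fin d) → ℝ} (hu : MemV Ω ν u) :
    (Vnorm2 Ω ν u).toReal ≤ (∫ x in Ω, u x ^ 2) + 2 * Λ * EForm Ω k u u := by
  obtain ⟨hm, h1, h2⟩ := (memV_iff hΩ hν0 hνs hνm hkm hΛ hk).1 hu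
  rw [memLp_two_iff_lint hm] at h1
  rw [memLp_two_iff_lint (measurable_dlt hm)] at h2
  rw [EForm_eq (k_nonneg hν0 hΛ hk) hkm]
  have e1 : (∫ x in Ω, u x ^ 2) = (∫⁻ x in Ω, ENNReal.ofReal (u x ^ 2)).toReal :=
    integral_eq_lintegral_of_nonneg_ae (Filter.Eventually.of_forall fun x => sq_nonneg (u x))
      (hm.pow_const 2).aestronglyMeasurable
  have e2 : (∫ p, dlt u p * dlt u p ∂(kMeas Ω k)) =
      (∫⁻ p, ENNReal.ofReal (dlt u p ^ 2) ∂(kMeas Ω k)).toReal := by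
    simp only [← sq]
    exact integral_eq_lintegral_of_nonneg_ae
      (Filter.Eventually.of_forall fun x => sq_nonneg (dlt u x))
      ((measurable_dlt hm).pow_const 2).aestronglyMeasurable
  have e3 := lemB (Ω := Ω) hν0 hνs hkm hΛ hk hm
  have e4 := ENNReal.toReal_mono (ENNReal.mul_lt_top ENNReal.ofReal_lt_top h2).ne e3
  rw [ENNReal.toReal_mul, ENNReal.toReal_ofReal (by linarith)] at e4
  rw [e1, e2]
  unfold Vnorm2
  refine ENNReal.toReal_add_le.trans ?_
  linarith

lemma ae_of_kMeas (hkm : Measurable (Function.uncurry k)) 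
    (hkp : ∀ x y, x ≠ y → 0 < k x y) 
    {P : EuclideanSpace ℝ (Fin d) × EuclideanSpace ℝ (Fin d) → Prop}
    (hP : ∀ᵐ p ∂(kMeas Ω k), P p) :
    ∀ᵐ x ∂(volume.restrict Ω), ∀ᵐ y, x ≠ y → P (x, y) := by
  have hm : Measurable fun p : EuclideanSpace ℝ (Fin d) × EuclideanSpace ℝ (Fin d) =>
    ENNReal.ofReal (k p.1 p.2) := hkm.ennreal_ofReal
  unfold kMeas at hP
  rw [ae_withDensity_iff hm] at hP
  have hset : (Ω ×ˢ univ) ⊆ (Ωᶜ ×ˢ Ωᶜ)ᶜ := by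
    rintro ⟨x, y⟩ h
    simp at h ⊢
    tauto
  have h2 := ae_restrict_of_ae_restrict_of_subset hset hP
  rw [← Measure.prod_restrict, Measure.restrict_univ] at h2
  have h3 := Measure.ae_ae_of_ae_prod h2
  filter_upwards [h3] with x hx
  filter_upwards [hx] with y hy hxy
  exact hy (by simpa using hkp x y hxy)

lemma kMeas_ac : kMeas Ω k ≪ (volume.prod volume) :=
  (withDensity_absolutelyContinuous _ _).trans Measure.absolutelyContinuous_restrict

end

/-- the inhomogeneous variational Neumann problem
`E(u,v) = ⟨f,v⟩ + ⟨g,v⟩` for all `v ∈ V_ν(Ω|ℝ^d)` is solvable iff the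
compatibility condition `⟨f,1⟩ + ⟨g,1⟩ = 0` holds; solutions are unique up to
additive constants, and under compatibility there is a mean-zero solution. -/
theorem neumann_solvable_iff_compatible
    (d : ℕ) (Ω : Set (EuclideanSpace ℝ (Fin d)))
    (hΩo : IsOpen Ω) (hΩb : Bornology.IsBounded Ω)
    (ν : EuclideanSpace ℝ (Fin d) → ℝ)
    (hν0 : ∀ h, 0 ≤ ν h) (hνm : Measurable ν) (hνs : ∀ h, ν (-h) = ν h)
    (hlevy : Integrable (fun h => min 1 (‖h‖ ^ 2) * ν h))
    (hsupp : ∀ h, h ≠ 0 → 0 < ν h)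
    (k : EuclideanSpace ℝ (Fin d) → EuclideanSpace ℝ (Fin d) → ℝ)
    (hkm : Measurable (Function.uncurry k)) (hks : ∀ x y, k x y = k y x)
    (Λ : ℝ) (hΛ : 1 ≤ Λ)
    (hk : ∀ x y, Λ⁻¹ * ν (y - x) ≤ k x y ∧ k x y ≤ Λ * ν (y - x))
    (C₀ : ℝ) (hC₀ : 0 < C₀)
    (hPoin : ∀ v, MemV Ω ν v → (∫ x in Ω, v x) = 0 →
      (∫ x in Ω, (v x) ^ 2) ≤ C₀ * EForm Ω k v v)
    (f g : (EuclideanSpace ℝ (Fin d) → ℝ) → ℝ) (Cf Cg : ℝ)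
    (hfadd : ∀ v w, MemV Ω ν v → MemV Ω ν w → f (v + w) = f v + f w)
    (hfsmul : ∀ (a : ℝ) v, MemV Ω ν v → f (a • v) = a * f v)
    (hfbd : ∀ v, MemV Ω ν v → |f v| ≤ Cf * Real.sqrt (Vnorm2 Ω ν v).toReal)
    (hgadd : ∀ v w, MemV Ω ν v → MemV Ω ν w → g (v + w) = g v + g w)
    (hgsmul : ∀ (a : ℝ) v, MemV Ω ν v → g (a • v) = a * g v)
    (hgres : ∀ v w, (∀ x ∉ Ω, v x = w x) → g v = g w)
    (hgbd : ∀ v, MemV Ω ν v → |g v| ≤ Cg * Real.sqrt (Vnorm2 Ω ν v).toReal) :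
    ((∃ u, MemV Ω ν u ∧ ∀ v, MemV Ω ν v → EForm Ω k u v = f v + g v)
        ↔ f (fun _ => (1 : ℝ)) + g (fun _ => (1 : ℝ)) = 0)
    ∧ (∀ u u', MemV Ω ν u → MemV Ω ν u' →
        (∀ v, MemV Ω ν v → EForm Ω k u v = f v + g v) →
        (∀ v, MemV Ω ν v → EForm Ω k u' v = f v + g v) →
        ∃ c : ℝ, Vnorm2 Ω ν (fun x => u' x - (u x + c)) = 0)
    ∧ (f (fun _ => (1 : ℝ)) + g (fun _ => (1 : ℝ)) = 0 →
        ∃ u, MemV Ω ν u ∧ (∫ x in Ω, u x) = 0 ∧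
          ∀ v, MemV Ω ν v → EForm Ω k u v = f v + g v) := by
  have hΩ : MeasurableSet Ω := hΩo.measurableSet
  have hk0 := k_nonneg hν0 hΛ hk
  have hΛ0 : 0 < Λ := by linarith
  have hkp : ∀ x y, x ≠ y → 0 < k x y := fun x y hxy =>
    lt_of_lt_of_le (mul_pos (inv_pos.2 hΛ0) (hsupp _ (sub_ne_zero.2 hxy.symm))) (hk x y).1
  have hIff : ∀ u, MemV Ω ν u ↔ Measurable u ∧ MemLp u 2 (volume.restrict Ω) ∧
      MemLp (dlt u) 2 (kMeas Ω k) := fun u => memV_iff hΩ hν0 hνs hνm hkm hΛ hk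
  have hE := EForm_eq (Ω := Ω) hk0 hkm
  have hfin : IsFiniteMeasure ((volume : Measure (EuclideanSpace ℝ (Fin d))).restrict Ω) :=
    ⟨by simpa using hΩb.measure_lt_top⟩
  have hdadd : ∀ v w : EuclideanSpace ℝ (Fin d) → ℝ, dlt (v + w) = dlt v + dlt w := by
    intro v w; ext p; simp [dlt]; ring
  have hdsmul : ∀ (a : ℝ) (v : EuclideanSpace ℝ (Fin d) → ℝ), dlt (a • v) = a • dlt v := by
    intro a v; ext p; simp [dlt]; ring
  have hdconst : ∀ c : ℝ, dlt (fun _ : EuclideanSpace ℝ (Fin d) => c) = 0 := by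
    intro c; ext p; simp [dlt]
  have hVadd : ∀ v w, MemV Ω ν v → MemV Ω ν w → MemV Ω ν (v + w) := by
    intro v w hv hw
    rw [hIff] at *
    refine ⟨hv.1.add hw.1, hv.2.1.add hw.2.1, ?_⟩
    rw [hdadd]; exact hv.2.2.add hw.2.2
  have hVsmul : ∀ (a : ℝ) v, MemV Ω ν v → MemV Ω ν (a • v) := by
    intro a v hv
    rw [hIff] at *
    refine ⟨hv.1.const_smul a, hv.2.1.const_smul a, ?_⟩
    rw [hdsmul]; exact hv.2.2.const_smul a
  have hVconst : ∀ c : ℝ, MemV Ω ν (fun _ => c) := by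
    intro c
    rw [hIff]
    refine ⟨measurable_const, memLp_const c, ?_⟩
    rw [hdconst]; exact MemLp.zero
  -- subtracting the mean
  have hmean : ∀ v, MemV Ω ν v → ∃ c : ℝ, MemV Ω ν (v + fun _ => c) ∧
      (∫ x in Ω, (v x + c)) = 0 ∧ dlt (v + fun _ => c) = dlt v := by
    intro v hv
    refine ⟨-((∫ x in Ω, v x) / (volume.restrict Ω).real univ), hVadd _ _ hv (hVconst _), ?_, ?_⟩
    · have hi : Integrable v (volume.restrict Ω) := ((hIff v).1 hv).2.1.integrable (by norm_num)
      rw [integral_add hi (integrable_const _), integral_const, smul_eq_mul]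
      by_cases h0 : (volume.restrict Ω).real univ = 0
      · have : (volume.restrict Ω : Measure (EuclideanSpace ℝ (Fin d))) = 0 := by
          rwa [measureReal_eq_zero_iff, Measure.measure_univ_eq_zero] at h0
        rw [this]; simp
      · field_simp
        ring
    · rw [hdadd, hdconst, add_zero]
  have hF1 : ∀ c : ℝ, f (fun _ => c) + g (fun _ => c)
      = c * (f (fun _ => (1 : ℝ)) + g (fun _ => (1 : ℝ))) := by
    intro c
    have e : (fun _ : EuclideanSpace ℝ (Fin d) => c) = c • (fun _ => (1 : ℝ)) := by ext; simp
    rw [e, hfsmul c _ (hVconst 1), hgsmul c _ (hVconst 1)]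
    ring
  have hnec : (∃ u, MemV Ω ν u ∧ ∀ v, MemV Ω ν v → EForm Ω k u v = f v + g v) →
      f (fun _ => (1 : ℝ)) + g (fun _ => (1 : ℝ)) = 0 := by
    rintro ⟨u, -, hu⟩
    rw [← hu _ (hVconst 1), hE, hdconst]
    simp
  have hexist : f (fun _ => (1 : ℝ)) + g (fun _ => (1 : ℝ)) = 0 →
        ∃ u, MemV Ω ν u ∧ (∫ x in Ω, u x) = 0 ∧
          ∀ v, MemV Ω ν v → EForm Ω k u v = f v + g v := by
    intro hcomp
    -- it suffices to solve against mean-zero test functions, and without the mean-zero condition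
    suffices H : ∃ u, MemV Ω ν u ∧ ∀ v, MemV Ω ν v → (∫ x in Ω, v x) = 0 →
        EForm Ω k u v = f v + g v by
      obtain ⟨u, hu, huv⟩ := H
      obtain ⟨c, hc1, hc2, hc3⟩ := hmean u hu
      refine ⟨_, hc1, hc2, fun v hv => ?_⟩
      obtain ⟨b, hb1, hb2, hb3⟩ := hmean v hv
      have := huv _ hb1 hb2
      rw [hfadd _ _ hv (hVconst b), hgadd _ _ hv (hVconst b)] at this
      have h1 := hF1 b
      rw [hcomp, mul_zero] at h1
      rw [hE] at this ⊢
      rw [hb3] at this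
      rw [hc3, this]
      linarith
    rcases Ω.eq_empty_or_nonempty with hemp | hne
    · refine ⟨fun _ => 0, hVconst 0, fun v hv _ => ?_⟩
      have h0 : Vnorm2 Ω ν v = 0 := by subst hemp; simp [Vnorm2]
      have h1 := hfbd v hv
      have h2 := hgbd v hv
      rw [h0] at h1 h2
      simp at h1 h2
      rw [hE, hdconst, h1, h2]
      simp
    let V0 : Submodule ℝ (EuclideanSpace ℝ (Fin d) → ℝ) :=
      { carrier := {u | MemV Ω ν u ∧ (∫ x in Ω, u x) = 0}
        add_mem' := by
          rintro v w ⟨hv, hv0⟩ ⟨hw, hw0⟩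
          refine ⟨hVadd _ _ hv hw, ?_⟩
          simp only [Pi.add_apply]
          rw [integral_add (((hIff v).1 hv).2.1.integrable (by norm_num))
            (((hIff w).1 hw).2.1.integrable (by norm_num)), hv0, hw0, add_zero]
        zero_mem' := ⟨hVconst 0, by simp⟩
        smul_mem' := by
          rintro a v ⟨hv, hv0⟩
          refine ⟨hVsmul _ _ hv, ?_⟩
          simp only [Pi.smul_apply]
          rw [integral_smul, hv0, smul_zero] }
    have hA : ∀ v : V0, MemLp (v : EuclideanSpace ℝ (Fin d) → ℝ) 2 (volume.restrict Ω) :=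
      fun v => ((hIff _).1 v.2.1).2.1
    have hJ : ∀ v : V0, MemLp (dlt (v : EuclideanSpace ℝ (Fin d) → ℝ)) 2 (kMeas Ω k) :=
      fun v => ((hIff _).1 v.2.1).2.2
    let A : V0 →ₗ[ℝ] Lp ℝ 2 (volume.restrict Ω) :=
      { toFun := fun v => (hA v).toLp _
        map_add' := fun v w => MemLp.toLp_add (hA v) (hA w)
        map_smul' := fun a v => MemLp.toLp_const_smul a (hA v) }
    let J : V0 →ₗ[ℝ] Lp ℝ 2 (kMeas Ω k) :=
      { toFun := fun v => (hJ v).toLp _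
        map_add' := fun v w => by
          rw [← MemLp.toLp_add (hJ v) (hJ w)]
          exact MemLp.toLp_congr _ _ (by rw [← hdadd]; rfl)
        map_smul' := fun a v => by
          rw [RingHom.id_apply, ← MemLp.toLp_const_smul a (hJ v)]
          exact MemLp.toLp_congr _ _ (by rw [← hdsmul]; rfl) }
    let F : V0 →ₗ[ℝ] ℝ :=
      { toFun := fun v => f v + g v
        map_add' := fun v w => by
          rw [Submodule.coe_add, hfadd _ _ v.2.1 w.2.1, hgadd _ _ v.2.1 w.2.1]; ring
        map_smul' := fun a v => by
          rw [Submodule.coe_smul, hfsmul _ _ v.2.1, hgsmul _ _ v.2.1, RingHom.id_apply,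
            smul_eq_mul]; ring }
    have hEJ : ∀ v : V0, EForm Ω k v v = (1 / 2) * ‖J v‖ ^ 2 := fun v => by
      rw [hE]
      have := norm_sq_toLp_two (hJ v)
      simp only [J, LinearMap.coe_mk, AddHom.coe_mk]
      rw [this]
      simp [sq]
    have hAJ : ∀ v : V0, ‖A v‖ ^ 2 ≤ C₀ / 2 * ‖J v‖ ^ 2 := fun v => by
      have h1 := hPoin v v.2.1 v.2.2
      rw [hEJ] at h1
      have : ‖A v‖ ^ 2 = _ := norm_sq_toLp_two (hA v)
      rw [this]
      linarith
    have hVJ : ∀ v : V0, Real.sqrt (Vnorm2 Ω ν v).toReal ≤ Real.sqrt (C₀ / 2 + Λ) * ‖J v‖ := by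
      intro v
      have h1 := Vnorm2_le hΩ hν0 hνs hνm hkm hΛ hk v.2.1
      have h2 := hPoin v v.2.1 v.2.2
      rw [hEJ] at h1 h2
      rw [← Real.sqrt_sq (norm_nonneg (J v)), ← Real.sqrt_mul (by positivity)]
      apply Real.sqrt_le_sqrt
      nlinarith
    have hFJ : ∀ v, |F v| ≤ ((|Cf| + |Cg|) * Real.sqrt (C₀ / 2 + Λ)) * ‖J v‖ := by
      intro v
      have h1 := hfbd v v.2.1
      have h2 := hgbd v v.2.1
      have h3 := hVJ v
      have h4 := Real.sqrt_nonneg (Vnorm2 Ω ν v).toReal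
      calc |F v| ≤ |f v| + |g v| := abs_add_le _ _
        _ ≤ Cf * Real.sqrt (Vnorm2 Ω ν v).toReal + Cg * Real.sqrt (Vnorm2 Ω ν v).toReal := by
            linarith
        _ ≤ (|Cf| + |Cg|) * Real.sqrt (Vnorm2 Ω ν v).toReal := by
            nlinarith [mul_le_mul_of_nonneg_right (le_abs_self Cf) h4,
              mul_le_mul_of_nonneg_right (le_abs_self Cg) h4]
        _ ≤ (|Cf| + |Cg|) * (Real.sqrt (C₀ / 2 + Λ) * ‖J v‖) := by gcongr
        _ = _ := by ring
    obtain ⟨w, h, hwl, hh⟩ := riesz_closure J F _ hFJ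
    -- the sequence is Cauchy in `L²(Ω)`
    have hAJ' : ∀ v : V0, ‖A v‖ ≤ Real.sqrt (C₀ / 2) * ‖J v‖ := fun v => by
      rw [← Real.sqrt_sq (norm_nonneg (J v)), ← Real.sqrt_mul (by positivity)]
      exact Real.le_sqrt_of_sq_le (hAJ v)
    have hcau : CauchySeq (fun n => A (w n)) := by
      have hc := hwl.cauchySeq
      rw [Metric.cauchySeq_iff] at hc ⊢
      intro ε hε
      obtain ⟨N, hN⟩ := hc (ε / (Real.sqrt (C₀ / 2) + 1)) (by positivity)
      refine ⟨N, fun m hm n hn => ?_⟩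
      have h1 := hN m hm n hn
      rw [dist_eq_norm, ← map_sub, lt_div_iff₀ (by positivity)] at h1
      rw [dist_eq_norm, ← map_sub]
      have h2 := hAJ' (w m - w n)
      nlinarith [norm_nonneg (J (w m - w n))]
    obtain ⟨a, ha⟩ := cauchySeq_tendsto_of_complete hcau
    obtain ⟨ns, hns, hnsa⟩ := exists_subseq_ae (fun n => hA (w n)) a ha
    obtain ⟨ms, hms, hmsh⟩ := exists_subseq_ae (fun n => hJ (w (ns n))) h
      (hwl.comp hns.tendsto_atTop)
    let s : ℕ → EuclideanSpace ℝ (Fin d) → ℝ := fun n => w (ns (ms n))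
    have hsm : ∀ n, Measurable (s n) := fun n => ((hIff _).1 (w (ns (ms n))).2.1).1
    have hsa : ∀ᵐ x ∂(volume.restrict Ω),
        Filter.Tendsto (fun n => s n x) Filter.atTop (nhds (a x)) := by
      filter_upwards [hnsa] with x hx
      exact hx.comp hms.tendsto_atTop
    have hsh : ∀ᵐ p ∂(kMeas Ω k),
        Filter.Tendsto (fun n => dlt (s n) p) Filter.atTop (nhds (h p)) := hmsh
    have hvol : (volume.restrict Ω : Measure (EuclideanSpace ℝ (Fin d))) ≠ 0 := by
      rw [Ne, Measure.restrict_eq_zero]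
      exact (hΩo.measure_pos volume hne).ne'
    have : Filter.NeBot (ae (volume.restrict Ω : Measure (EuclideanSpace ℝ (Fin d)))) :=
      ae_neBot.2 hvol
    obtain ⟨x0, hx0, hx0'⟩ := (hsa.and (ae_of_kMeas hkm hkp hsh)).exists
    have hlim : ∀ᵐ y : EuclideanSpace ℝ (Fin d),
        ∃ l, Filter.Tendsto (fun n => s n y) Filter.atTop (nhds l) := by
      filter_upwards [hx0'] with y hy
      by_cases hxy : x0 = y
      · exact ⟨_, hxy ▸ hx0⟩
      · refine ⟨_, (hx0.sub (hy hxy)).congr fun n => ?_⟩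
        simp [dlt]
    obtain ⟨u, hum, hu⟩ := measurable_limit_of_tendsto_metrizable_ae
      (fun n => (hsm n).aemeasurable) hlim
    have hua : u =ᵐ[volume.restrict Ω] a := by
      filter_upwards [hsa, ae_restrict_of_ae hu] with x h1 h2
      exact tendsto_nhds_unique h2 h1
    have huh : dlt u =ᵐ[kMeas Ω k] h := by
      have h1 : ∀ᵐ p ∂(kMeas Ω k),
          Filter.Tendsto (fun n => s n p.1) Filter.atTop (nhds (u p.1)) :=
        kMeas_ac.ae_le (Measure.quasiMeasurePreserving_fst.ae hu)
      have h2 : ∀ᵐ p ∂(kMeas Ω k),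
          Filter.Tendsto (fun n => s n p.2) Filter.atTop (nhds (u p.2)) :=
        kMeas_ac.ae_le (Measure.quasiMeasurePreserving_snd.ae hu)
      filter_upwards [h1, h2, hsh] with p h1 h2 h3
      exact tendsto_nhds_unique (h1.sub h2) h3
    have huJ : MemLp (dlt u) 2 (kMeas Ω k) := (Lp.memLp h).ae_eq huh.symm
    have huJ' : huJ.toLp (dlt u) = h := by
      rw [← Lp.toLp_coeFn h (Lp.memLp h)]
      exact MemLp.toLp_congr _ _ huh
    have huV : MemV Ω ν u := (hIff u).2 ⟨hum, (Lp.memLp a).ae_eq hua.symm, huJ⟩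
    refine ⟨(2 : ℝ) • u, hVsmul _ _ huV, fun v hv hv0 => ?_⟩
    have h1 := hh ⟨v, hv, hv0⟩
    rw [← huJ'] at h1
    have h2 : inner ℝ (huJ.toLp (dlt u)) (J ⟨v, hv, hv0⟩) = _ :=
      inner_toLp_two huJ (hJ ⟨v, hv, hv0⟩)
    rw [h2] at h1
    rw [hE, hdsmul]
    have h3 : (∫ p, ((2 : ℝ) • dlt u) p * dlt v p ∂(kMeas Ω k))
        = 2 * ∫ p, dlt u p * dlt v p ∂(kMeas Ω k) := by
      rw [← integral_const_mul]
      congr 1; ext p; simp; ring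
    have h4 : F ⟨v, hv, hv0⟩ = f v + g v := rfl
    rw [h3, ← h4, ← h1]
    simp
  refine ⟨⟨hnec, fun hc => ?_⟩, ?_, hexist⟩
  · obtain ⟨u, h1, -, h2⟩ := hexist hc
    exact ⟨u, h1, h2⟩
  · intro u u' hu hu' h1 h2
    have hw : MemV Ω ν (u' + (-1 : ℝ) • u) := hVadd _ _ hu' (hVsmul _ _ hu)
    obtain ⟨c, hc1, hc2, hc3⟩ := hmean _ hw
    refine ⟨-c, ?_⟩
    set z := (u' + (-1 : ℝ) • u) + fun _ => c with hz
    have ez : (fun x => u' x - (u x + -c)) = z := by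
      ext x; simp [hz]; ring
    rw [ez]
    have hzz : EForm Ω k z z = 0 := by
      have e1 := h1 z hc1
      have e2 := h2 z hc1
      rw [hE] at e1 e2 ⊢
      have hi1 : Integrable (fun p => dlt u p * dlt z p) (kMeas Ω k) :=
        (((hIff _).1 hu).2.2).integrable_mul (((hIff _).1 hc1).2.2)
      have hi2 : Integrable (fun p => dlt u' p * dlt z p) (kMeas Ω k) :=
        (((hIff _).1 hu').2.2).integrable_mul (((hIff _).1 hc1).2.2)
      have e3 : (∫ p, dlt z p * dlt z p ∂(kMeas Ω k))
          = (∫ p, dlt u' p * dlt z p ∂(kMeas Ω k)) - ∫ p, dlt u p * dlt z p ∂(kMeas Ω k) := by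
        rw [← integral_sub hi2 hi1]
        congr 1; ext p
        have : dlt z p = dlt u' p - dlt u p := by
          rw [hc3, hdadd, hdsmul]; simp; ring
        nth_rewrite 1 [this]
        ring
      rw [e3]
      linarith
    have p1 := hPoin z hc1 hc2
    have p2 := Vnorm2_le hΩ hν0 hνs hνm hkm hΛ hk hc1
    rw [hzz] at p1 p2
    have p3 : (Vnorm2 Ω ν z).toReal = 0 :=
      le_antisymm (by linarith) ENNReal.toReal_nonneg
    rcases (ENNReal.toReal_eq_zero_iff _).1 p3 with h | h
    · exact h
    · exact absurd h hc1.2.ne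
end
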